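/- Let D ∈ Mat_N be a nonzero trace-free anti-hermitian matrix with exactly k distinct eigenvalues, where k is odd, and suppose D is similar to −D. Then the number of equivalence classes of the relation ~_D on the set of nonzero row vectors of ℂ^N equals 2^{(k−1)/2}·(1 + 2^{(k−1)/2}) − 1. -/

import Mathlib

open Matrix

/-- The relation `~_D` on nonzero row vectors of `ℂ^N`: `v ~_D v'` iff there are `U ∈ GL(N,ℂ)`,
`μ ∈ ℝ∖{0}` and `x ∈ ℂ∖{0}` with `D = μ U⁻¹ D U` and `v' = μ x (v U)`. Its classes are the
isomorphism classes of real calculi `(Mat_N, ⟨∂⟩_D, ℂ^N, φ)`. -/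
def simRel {N : ℕ} (D : Matrix (Fin N) (Fin N) ℂ)
    (v w : {v : Fin N → ℂ // v ≠ 0}) : Prop :=
  ∃ (U : GL (Fin N) ℂ) (μ : ℝ) (x : ℂ), μ ≠ 0 ∧ x ≠ 0 ∧
    D = (μ : ℂ) • ((U⁻¹).val * D * U.val) ∧
    (w : Fin N → ℂ) = ((μ : ℂ) * x) • Matrix.vecMul (v : Fin N → ℂ) U.val

open Finset in
lemma comb_invol {T Q : Type*} [Fintype T] [Fintype Q] [DecidableEq T] [DecidableEq Q] (σ : T → T)
    (hσ : ∀ t, σ (σ t) = t) (p : T → Q) (hp : Function.Surjective p)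
    (h : ∀ s t, p s = p t ↔ (t = s ∨ t = σ s)) :
    2 * Fintype.card Q = Fintype.card T + (univ.filter (fun t => σ t = t)).card := by
  have h1 : ∑ t : T, (1 + if σ t = t then 1 else 0) = ∑ q : Q, 2 := by
    rw [← Finset.sum_fiberwise (s := univ) (g := p)]
    refine Finset.sum_congr rfl fun q _ => ?_
    obtain ⟨s, rfl⟩ := hp q
    have : univ.filter (fun t => p t = p s) = {s, σ s} := by
      ext t
      simp only [mem_filter, mem_univ, true_and, mem_insert, mem_singleton]
      rw [eq_comm, h]
    rw [this]
    by_cases hs : σ s = s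
    · simp [hs]
    · rw [Finset.sum_pair (Ne.symm hs)]
      simp [hs, hσ, Ne.symm hs]
  rw [Finset.sum_add_distrib] at h1
  simp only [sum_const, card_univ, smul_eq_mul, mul_one, Finset.sum_boole, Nat.cast_id] at h1
  omega

open Finset in
lemma comb_half (Sp : Finset ℝ) (m : ℕ) (hneg : Sp.image (fun x => -x) = Sp) (hc : Sp.card = 2 * m + 1) :
    (Sp.filter (fun x => 0 ≤ x)).card = m + 1 := by
  have hm : ∀ x, x ∈ Sp → -x ∈ Sp := fun x hx => by
    rw [← hneg]; exact mem_image_of_mem _ hx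
  have h1 : (Sp.filter (fun x => 0 < x)).card = (Sp.filter (fun x => x < 0)).card := by
    refine card_bij (fun x _ => -x) ?_ ?_ ?_
    · intro x hx; simp at hx ⊢; exact ⟨hm x hx.1, hx.2⟩
    · intro x _ y _ h; simpa using h
    · intro y hy; simp at hy; exact ⟨-y, by simp; exact ⟨hm y hy.1, hy.2⟩, by simp⟩
  have h2 := card_filter_add_card_filter_not (s := Sp) (fun x => 0 ≤ x)
  have h3 : Sp.filter (fun x => ¬ 0 ≤ x) = Sp.filter (fun x => x < 0) := by
    ext x; simp
  have h4 := card_filter_add_card_filter_not (s := Sp.filter (fun x => 0 ≤ x)) (fun x => 0 < x)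
  have h5 : (Sp.filter (fun x => 0 ≤ x)).filter (fun x => 0 < x) = Sp.filter (fun x => 0 < x) := by
    ext x; simp only [mem_filter]; exact ⟨fun h => ⟨h.1.1, h.2⟩, fun h => ⟨⟨h.1, h.2.le⟩, h.2⟩⟩
  have h6 : ((Sp.filter (fun x => 0 ≤ x)).filter (fun x => ¬ 0 < x)).card ≤ 1 := by
    refine (card_le_card (t := {0}) ?_).trans (by simp)
    intro x hx; simp at hx ⊢; linarith [hx.2, hx.1.2]
  rw [h3] at h2; rw [h5] at h4
  omega

open Finset in
lemma comb_fix (Sp : Finset ℝ) (hneg : Sp.image (fun x => -x) = Sp) :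
    (Sp.powerset.filter (fun S => S.image (fun x => -x) = S)).card
      = 2 ^ (Sp.filter (fun x => 0 ≤ x)).card := by
  have hm : ∀ x, x ∈ Sp → -x ∈ Sp := fun x hx => by
    rw [← hneg]; exact mem_image_of_mem _ hx
  rw [← card_powerset]
  refine card_bij' (fun S _ => S.filter (fun x => 0 ≤ x)) (fun S _ => S ∪ S.image (fun x => -x)) ?_ ?_ ?_ ?_
  · intro S hS
    simp only [mem_filter, mem_powerset] at hS ⊢
    exact filter_subset_filter _ hS.1
  · intro S hS
    simp only [mem_filter, mem_powerset] at hS ⊢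
    constructor
    · intro x hx
      simp only [mem_union, mem_image] at hx
      rcases hx with hx | ⟨y, hy, rfl⟩
      · exact (mem_filter.1 (hS hx)).1
      · exact hm _ (mem_filter.1 (hS hy)).1
    · rw [image_union, image_image]
      simp [union_comm]
  · intro S hS
    simp only [mem_filter, mem_powerset] at hS
    have hS' : ∀ x, x ∈ S → -x ∈ S := fun x hx => by
      rw [← hS.2]; exact mem_image_of_mem _ hx
    ext x
    simp only [mem_union, mem_image, mem_filter]
    constructor
    · rintro (h | ⟨y, h, rfl⟩)
      · exact h.1
      · exact hS' _ h.1
    · intro h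
      rcases le_total 0 x with hx | hx
      · exact Or.inl ⟨h, hx⟩
      · exact Or.inr ⟨-x, ⟨hS' _ h, by linarith⟩, by simp⟩
  · intro S hS
    simp only [mem_powerset] at hS
    ext x
    simp only [mem_union, mem_image, mem_filter]
    constructor
    · rintro ⟨h | ⟨y, h, rfl⟩, hx⟩
      · exact h
      · have := (mem_filter.1 (hS h)).2
        have : y = 0 := by linarith
        subst this; simpa using h
    · intro h
      exact ⟨Or.inl h, (mem_filter.1 (hS h)).2⟩

open Finset in
/-- Abstract count: a surjection onto nonempty subsets, relation = equality up to negation. -/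
lemma comb_count {V : Type*} (r : V → V → Prop) (Sp : Finset ℝ) (m : ℕ)
    (hneg : Sp.image (fun x => -x) = Sp) (hc : Sp.card = 2 * m + 1)
    (f : V → Finset ℝ) (hf1 : ∀ v, (f v).Nonempty ∧ f v ⊆ Sp)
    (hf2 : ∀ S : Finset ℝ, S.Nonempty → S ⊆ Sp → ∃ v, f v = S)
    (hr : ∀ v w, r v w ↔ (f w = f v ∨ f w = (f v).image (fun x => -x))) :
    Nat.card (Quot r) = 2 ^ m * (1 + 2 ^ m) - 1 := by
  classical
  have hnn : ∀ S : Finset ℝ, (S.image (fun x => -x)).image (fun x => -x) = S := by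
    intro S; rw [image_image]; simp
  have heq : Equivalence r := by
    refine ⟨fun v => (hr v v).2 (Or.inl rfl), ?_, ?_⟩
    · intro v w h
      rw [hr] at h ⊢
      rcases h with h | h
      · exact Or.inl h.symm
      · right; rw [h, hnn]
    · intro u v w h1 h2
      rw [hr] at h1 h2 ⊢
      rcases h1 with h1 | h1 <;> rcases h2 with h2 | h2 <;> rw [h2, h1]
      · left; rfl
      · right; rfl
      · right; rfl
      · left; rw [hnn]
  let T := {S : Finset ℝ // S ∈ Sp.powerset.erase ∅}
  have hT : ∀ S : T, S.1.Nonempty ∧ S.1 ⊆ Sp := by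
    intro S
    have := S.2
    simp only [mem_erase, mem_powerset] at this
    exact ⟨nonempty_iff_ne_empty.2 this.1, this.2⟩
  have hmk : ∀ S : Finset ℝ, S.Nonempty → S ⊆ Sp → S ∈ Sp.powerset.erase ∅ := by
    intro S h1 h2
    simp only [mem_erase, mem_powerset]
    exact ⟨nonempty_iff_ne_empty.1 h1, h2⟩
  let σ : T → T := fun S => ⟨S.1.image (fun x => -x), hmk _ ((hT S).1.image _)
    ((image_subset_image (hT S).2).trans hneg.le)⟩
  choose g hg using fun S : T => hf2 S.1 (hT S).1 (hT S).2
  let p : T → Quot r := fun S => Quot.mk r (g S)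
  have hp : Function.Surjective p := by
    intro q
    induction q using Quot.ind with
    | mk v =>
      refine ⟨⟨f v, hmk _ (hf1 v).1 (hf1 v).2⟩, ?_⟩
      apply Quot.sound
      rw [hr, hg]; left; rfl
  have : Finite (Quot r) := Finite.of_surjective p hp
  have : Fintype (Quot r) := Fintype.ofFinite _
  have key := comb_invol σ (fun S => Subtype.ext (hnn S.1)) p hp (by
    intro s t
    show Quot.mk r _ = Quot.mk r _ ↔ _
    rw [Quot.eq, heq.eqvGen_iff, hr, hg, hg, Subtype.ext_iff, Subtype.ext_iff])
  have c1 : Fintype.card T = 2 ^ (2 * m + 1) - 1 := by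
    rw [Fintype.card_coe, card_erase_of_mem (by simp), card_powerset, hc]
  have c2 : (univ.filter (fun t : T => σ t = t)).card = 2 ^ (m + 1) - 1 := by
    rw [← comb_half Sp m hneg hc, ← comb_fix Sp hneg]
    rw [← card_erase_of_mem (a := ∅) (by simp)]
    refine card_bij (fun t _ => t.1) ?_ ?_ ?_
    · intro t ht
      simp only [mem_filter, mem_univ, true_and] at ht
      simp only [mem_erase, mem_filter, mem_powerset]
      exact ⟨nonempty_iff_ne_empty.1 (hT t).1, (hT t).2, congrArg Subtype.val ht⟩
    · intro s _ t _ h; exact Subtype.ext h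
    · intro S hS
      simp only [mem_erase, mem_filter, mem_powerset] at hS
      refine ⟨⟨S, hmk S (nonempty_iff_ne_empty.2 hS.1) hS.2.1⟩, ?_, rfl⟩
      simp only [mem_filter, mem_univ, true_and]
      exact Subtype.ext hS.2.2
  rw [Nat.card_eq_fintype_card]
  rw [c1, c2] at key
  have e1 : 2 ^ (2 * m + 1) = 2 * (2 ^ m * 2 ^ m) := by ring
  have e2 : 2 ^ (m + 1) = 2 * 2 ^ m := by ring
  have e3 : 0 < 2 ^ m * 2 ^ m := by positivity
  have e4 : 0 < 2 ^ m := by positivity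
  rw [e1, e2] at key
  rw [mul_add, mul_one]
  omega

noncomputable def esupp {N : ℕ} (e : Fin N → ℝ) (a : Fin N → ℂ) : Finset ℝ :=
  open Classical in (Finset.univ.filter (fun i => a i ≠ 0)).image e

lemma mem_esupp {N : ℕ} (e : Fin N → ℝ) (a : Fin N → ℂ) (x : ℝ) :
    x ∈ esupp e a ↔ ∃ i, a i ≠ 0 ∧ e i = x := by
  simp [esupp]

noncomputable def idiag {N : ℕ} (e : Fin N → ℝ) : Matrix (Fin N) (Fin N) ℂ :=
  Matrix.diagonal (fun i => Complex.I * (e i : ℂ))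

lemma entry_rel {N : ℕ} (e : Fin N → ℝ) (U : Matrix (Fin N) (Fin N) ℂ) (μ : ℝ)
    (h : U * idiag e = (μ : ℂ) • (idiag e * U)) (i j : Fin N) (hij : U i j ≠ 0) :
    e j = μ * e i := by
  have := congrFun (congrFun h i) j
  simp only [idiag, Matrix.mul_diagonal, Matrix.smul_apply, Matrix.diagonal_mul, smul_eq_mul] at this
  have h2 : (U i j * Complex.I) * ((e j : ℂ) - μ * e i) = 0 := by linear_combination this
  rcases mul_eq_zero.1 h2 with h3 | h3
  · exact absurd h3 (mul_ne_zero hij Complex.I_ne_zero)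
  · have : (e j : ℂ) = ((μ * e i : ℝ) : ℂ) := by push_cast; linear_combination h3
    exact_mod_cast this

lemma row_rel {N : ℕ} (e : Fin N → ℝ) (U V : Matrix (Fin N) (Fin N) ℂ) (hUV : U * V = 1) (μ : ℝ)
    (h : U * idiag e = (μ : ℂ) • (idiag e * U)) (i : Fin N) : ∃ j, e j = μ * e i := by
  by_contra hc
  push Not at hc
  have h0 : ∀ j, U i j = 0 := fun j => by
    by_contra hj
    exact hc j (entry_rel e U μ h i j hj)
  have := congrFun (congrFun hUV i) i
  simp [Matrix.mul_apply, h0] at this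

lemma supp_sub {N : ℕ} (e : Fin N → ℝ) (U : Matrix (Fin N) (Fin N) ℂ) (μ : ℝ)
    (h : U * idiag e = (μ : ℂ) • (idiag e * U)) (a : Fin N → ℂ) (c : ℂ) (x : ℝ)
    (hx : x ∈ esupp e (c • Matrix.vecMul a U)) : ∃ y ∈ esupp e a, x = μ * y := by
  obtain ⟨j, hj, rfl⟩ := (mem_esupp _ _ _).1 hx
  have : Matrix.vecMul a U j ≠ 0 := fun h0 => hj (by simp [h0])
  rw [Matrix.vecMul, dotProduct] at this
  obtain ⟨i, -, hi⟩ := Finset.exists_ne_zero_of_sum_ne_zero this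
  exact ⟨e i, (mem_esupp _ _ _).2 ⟨i, left_ne_zero_of_mul hi, rfl⟩,
    entry_rel e U μ h i j (right_ne_zero_of_mul hi)⟩

lemma mu_le {N : ℕ} (e : Fin N → ℝ) (he : ∃ i, e i ≠ 0) (μ : ℝ)
    (h : ∀ i, ∃ j, e j = μ * e i) : |μ| ≤ 1 := by
  obtain ⟨i0, hi0⟩ := he
  have : Nonempty (Fin N) := ⟨i0⟩
  obtain ⟨i, hi⟩ := Finite.exists_max (fun i => |e i|)
  obtain ⟨j, hj⟩ := h i
  have h1 := hi j
  rw [hj, abs_mul] at h1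
  have h2 : 0 < |e i| := lt_of_lt_of_le (abs_pos.2 hi0) (hi i0)
  by_contra hc
  push Not at hc
  nlinarith

lemma supp_eq {N : ℕ} (e : Fin N → ℝ) (he : ∃ i, e i ≠ 0) (U V : Matrix (Fin N) (Fin N) ℂ)
    (hUV : U * V = 1) (hVU : V * U = 1) (μ : ℝ) (hμ : μ ≠ 0)
    (h : U * idiag e = (μ : ℂ) • (idiag e * U)) (a b : Fin N → ℂ) (c : ℂ) (hc : c ≠ 0)
    (hb : b = c • Matrix.vecMul a U) :
    esupp e b = esupp e a ∨ esupp e b = (esupp e a).image (fun x => -x) := by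
  have hμc : (μ : ℂ) ≠ 0 := by exact_mod_cast hμ
  have h' : V * idiag e = ((μ⁻¹ : ℝ) : ℂ) • (idiag e * V) := by
    have h1 : V * (U * idiag e) * V = (μ : ℂ) • (V * (idiag e * U) * V) := by
      rw [h]; simp
    have h2 : V * (U * idiag e) * V = idiag e * V := by rw [← mul_assoc, hVU, one_mul]
    have h3 : V * (idiag e * U) * V = V * idiag e := by
      rw [mul_assoc, mul_assoc, hUV, mul_one]
    rw [h2, h3] at h1
    rw [h1, smul_smul]
    push_cast
    rw [inv_mul_cancel₀ hμc, one_smul]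
  have ha : a = c⁻¹ • Matrix.vecMul b V := by
    rw [hb, Matrix.smul_vecMul, Matrix.vecMul_vecMul, hUV, Matrix.vecMul_one, smul_smul,
      inv_mul_cancel₀ hc, one_smul]
  have m1 := mu_le e he μ (row_rel e U V hUV μ h)
  have m2 := mu_le e he μ⁻¹ (row_rel e V U hVU μ⁻¹ h')
  have m3 : |μ| = 1 := by
    apply le_antisymm m1
    rw [abs_inv] at m2
    have := abs_pos.2 hμ
    by_contra hlt
    push Not at hlt
    have := (one_lt_inv₀ this).2 hlt
    linarith
  have s1 : ∀ x ∈ esupp e b, ∃ y ∈ esupp e a, x = μ * y := by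
    intro x hx; rw [hb] at hx; exact supp_sub e U μ h a c x hx
  have s2 : ∀ x ∈ esupp e a, ∃ y ∈ esupp e b, x = μ⁻¹ * y := by
    intro x hx; rw [ha] at hx; exact supp_sub e V μ⁻¹ h' b _ x hx
  rcases eq_or_eq_neg_of_abs_eq m3 with rfl | rfl
  · left
    ext x
    constructor
    · intro hx; obtain ⟨y, hy, rfl⟩ := s1 x hx; simpa using hy
    · intro hx; obtain ⟨y, hy, rfl⟩ := s2 x hx; simpa using hy
  · right
    ext x
    rw [Finset.mem_image]
    constructor
    · intro hx; obtain ⟨y, hy, rfl⟩ := s1 x hx; exact ⟨y, hy, by simp⟩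
    · rintro ⟨z, hz, rfl⟩
      obtain ⟨y, hy, rfl⟩ := s2 z hz
      simpa [inv_neg] using hy

/-- block-diagonal linear equivalence -/
def blockEquiv {N : ℕ} (e : Fin N → ℝ)
    (A : ∀ x : ℝ, ({i // e i = x} → ℂ) ≃ₗ[ℂ] ({i // e i = x} → ℂ)) :
    (Fin N → ℂ) ≃ₗ[ℂ] (Fin N → ℂ) where
  toFun u i := A (e i) (fun j => u j.1) ⟨i, rfl⟩
  invFun u i := (A (e i)).symm (fun j => u j.1) ⟨i, rfl⟩
  map_add' u v := by
    funext i
    exact congrFun ((A (e i)).map_add (fun j => u j.1) (fun j => v j.1)) ⟨i, rfl⟩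
  map_smul' c u := by
    funext i
    exact congrFun ((A (e i)).map_smul c (fun j => u j.1)) ⟨i, rfl⟩
  left_inv u := by
    funext i
    have : (fun j : {j // e j = e i} => A (e j.1) (fun l => u l.1) ⟨j.1, rfl⟩)
        = A (e i) (fun l => u l.1) := by
      funext ⟨j, hj⟩
      generalize e i = x at hj
      subst hj
      rfl
    show (A (e i)).symm (fun j : {j // e j = e i} => A (e j.1) (fun l => u l.1) ⟨j.1, rfl⟩) _ = _
    rw [this, LinearEquiv.symm_apply_apply]
  right_inv u := by
    funext i
    have : (fun j : {j // e j = e i} => (A (e j.1)).symm (fun l => u l.1) ⟨j.1, rfl⟩)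
        = (A (e i)).symm (fun l => u l.1) := by
      funext ⟨j, hj⟩
      generalize e i = x at hj
      subst hj
      rfl
    show (A (e i)) (fun j : {j // e j = e i} => (A (e j.1)).symm (fun l => u l.1) ⟨j.1, rfl⟩) _ = _
    rw [this, LinearEquiv.apply_symm_apply]

lemma block_trans {ι : Type*} [Finite ι] (a b : ι → ℂ) (h : a = 0 ↔ b = 0) :
    ∃ A : (ι → ℂ) ≃ₗ[ℂ] (ι → ℂ), A a = b := by
  have := Fintype.ofFinite ι
  by_cases ha : a = 0
  · exact ⟨LinearEquiv.refl _ _, by simp [ha, h.1 ha]⟩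
  · obtain ⟨A, hA⟩ := SeparatingDual.exists_continuousLinearEquiv_apply_eq (R := ℂ) ha
      (fun hb => ha (h.2 hb))
    exact ⟨A.toLinearEquiv, hA⟩

lemma exists_commuting {N : ℕ} (e : Fin N → ℝ) (a b : Fin N → ℂ) (h : esupp e b = esupp e a) :
    ∃ U : GL (Fin N) ℂ, U.val * idiag e = idiag e * U.val ∧ b = Matrix.vecMul a U.val := by
  have hz : ∀ x : ℝ, ∃ A : ({i // e i = x} → ℂ) ≃ₗ[ℂ] ({i // e i = x} → ℂ),
      A (fun j => a j.1) = fun j => b j.1 := by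
    intro x
    apply block_trans
    have key : ∀ c : Fin N → ℂ, ((fun j : {i // e i = x} => c j.1) = 0) ↔ x ∉ esupp e c := by
      intro c
      rw [mem_esupp, funext_iff]
      push Not
      constructor
      · intro H i hi hx; exact hi (H ⟨i, hx⟩)
      · intro H j; by_contra hj; exact H j.1 hj j.2
    rw [key, key, h]
  choose A hA using hz
  let T := blockEquiv e A
  have hT : T a = b := by
    funext i
    exact congrFun (hA (e i)) ⟨i, rfl⟩
  have hcomm : ∀ u, T (fun i => Complex.I * (e i : ℂ) * u i) =
      fun i => Complex.I * (e i : ℂ) * T u i := by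
    intro u
    funext i
    have : (fun j : {j // e j = e i} => Complex.I * (e j.1 : ℂ) * u j.1)
        = (Complex.I * (e i : ℂ)) • (fun j : {j // e j = e i} => u j.1) := by
      funext j
      simp [j.2]
    show A (e i) (fun j : {j // e j = e i} => Complex.I * (e j.1 : ℂ) * u j.1) _ = _
    rw [this, map_smul]
    rfl
  let M : Matrix (Fin N) (Fin N) ℂ := (LinearMap.toMatrix' T.toLinearMap)ᵀ
  let M' : Matrix (Fin N) (Fin N) ℂ := (LinearMap.toMatrix' T.symm.toLinearMap)ᵀ
  have hM : ∀ u, Matrix.vecMul u M = T u := by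
    intro u
    rw [Matrix.vecMul_transpose, LinearMap.toMatrix'_mulVec]; rfl
  have hM' : ∀ u, Matrix.vecMul u M' = T.symm u := by
    intro u
    rw [Matrix.vecMul_transpose, LinearMap.toMatrix'_mulVec]; rfl
  have ext' : ∀ X Y : Matrix (Fin N) (Fin N) ℂ, (∀ u, Matrix.vecMul u X = Matrix.vecMul u Y) → X = Y := by
    intro X Y H
    ext i j
    have := congrFun (H (Pi.single i 1)) j
    simpa using this
  have hD : ∀ u, Matrix.vecMul u (idiag e) = fun i => Complex.I * (e i : ℂ) * u i := by
    intro u; funext i; rw [idiag, Matrix.vecMul_diagonal, mul_comm]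
  refine ⟨⟨M, M', ext' _ _ fun u => ?_, ext' _ _ fun u => ?_⟩, ext' _ _ fun u => ?_, ?_⟩
  · rw [← Matrix.vecMul_vecMul, hM, hM']; simp
  · rw [← Matrix.vecMul_vecMul, hM, hM']; simp
  · show Matrix.vecMul u (M * _) = Matrix.vecMul u (_ * M)
    rw [← Matrix.vecMul_vecMul, ← Matrix.vecMul_vecMul, hM, hM, hD, hD, hcomm]
  · show b = Matrix.vecMul a M
    rw [hM, hT]

lemma intertwine {N : ℕ} (D : Matrix (Fin N) (Fin N) ℂ) (e : Fin N → ℝ) (P U : GL (Fin N) ℂ)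
    (hP : D = (P⁻¹).val * idiag e * P.val) (μ : ℂ) :
    D = μ • ((U⁻¹).val * D * U.val) ↔
      (P * U * P⁻¹).val * idiag e = μ • (idiag e * (P * U * P⁻¹).val) := by
  have e1 : ∀ (W : GL (Fin N) ℂ) (X Y : Matrix (Fin N) (Fin N) ℂ), X = Y ↔ W.val * X = W.val * Y :=
    fun W X Y => (Units.mul_right_inj W).symm
  have e2 : ∀ (W : GL (Fin N) ℂ) (X Y : Matrix (Fin N) (Fin N) ℂ), X = Y ↔ X * W.val = Y * W.val :=
    fun W X Y => (Units.mul_left_inj W).symm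
  rw [e1 (P * U), e2 P⁻¹, hP]
  simp only [Units.val_mul, Matrix.mul_smul, Matrix.smul_mul, mul_assoc, Units.mul_inv_cancel_left,
    Units.mul_inv, mul_one]

lemma main_count {N m : ℕ} (D : Matrix (Fin N) (Fin N) ℂ) (e : Fin N → ℝ) (P : GL (Fin N) ℂ)
    (hP : D = (P⁻¹).val * idiag e * P.val) (he : ∃ i, e i ≠ 0)
    (hc : (Finset.univ.image e).card = 2 * m + 1)
    (hsim : ∃ U : GL (Fin N) ℂ, -D = (U⁻¹).val * D * U.val) :
    Nat.card (Quot (simRel D)) = 2 ^ m * (1 + 2 ^ m) - 1 := by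
  obtain ⟨U0, hU0⟩ := hsim
  have hU0' : D = ((-1 : ℝ) : ℂ) • ((U0⁻¹).val * D * U0.val) := by rw [← hU0]; simp
  have hW := (intertwine D e P U0 hP _).1 hU0'
  set W := P * U0 * P⁻¹ with hWdef
  have hWe : ∀ i, ∃ j, e j = -e i := fun i => by
    simpa using row_rel e W.val (W⁻¹).val (by simp) (-1) hW i
  have hPi : ∀ v : Fin N → ℂ, v ≠ 0 → Matrix.vecMul v (P⁻¹).val ≠ 0 := by
    intro v hv h0
    apply hv
    have : Matrix.vecMul (Matrix.vecMul v (P⁻¹).val) P.val = 0 := by rw [h0, Matrix.zero_vecMul]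
    rwa [Matrix.vecMul_vecMul, Units.inv_mul, Matrix.vecMul_one] at this
  refine comb_count (simRel D) (Finset.univ.image e) m ?_ hc
    (fun v => esupp e (Matrix.vecMul v.1 (P⁻¹).val)) ?_ ?_ ?_
  · ext x
    simp only [Finset.mem_image, Finset.mem_univ, true_and]
    constructor
    · rintro ⟨_, ⟨i, rfl⟩, rfl⟩; exact hWe i
    · rintro ⟨i, rfl⟩
      obtain ⟨j, hj⟩ := hWe i
      exact ⟨e j, ⟨j, rfl⟩, by simp [hj]⟩
  · intro v
    constructor
    · obtain ⟨i, hi⟩ := Function.ne_iff.1 (hPi v.1 v.2)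
      exact ⟨e i, (mem_esupp _ _ _).2 ⟨i, hi, rfl⟩⟩
    · intro x hx
      obtain ⟨i, -, rfl⟩ := (mem_esupp _ _ _).1 hx
      simp
  · intro S hS hSs
    let a : Fin N → ℂ := fun i => open Classical in if e i ∈ S then 1 else 0
    have haS : esupp e a = S := by
      ext x
      rw [mem_esupp]
      constructor
      · rintro ⟨i, hi, rfl⟩
        by_contra h
        exact hi (by simp [a, h])
      · intro hx
        obtain ⟨i, -, rfl⟩ := Finset.mem_image.1 (hSs hx)
        exact ⟨i, by simp [a, hx], rfl⟩
    have hvv : Matrix.vecMul (Matrix.vecMul a P.val) (P⁻¹).val = a := by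
      rw [Matrix.vecMul_vecMul, Units.mul_inv, Matrix.vecMul_one]
    refine ⟨⟨Matrix.vecMul a P.val, fun h0 => ?_⟩, by simp only [hvv, haS]⟩
    rw [h0, Matrix.zero_vecMul] at hvv
    obtain ⟨x, hx⟩ := hS
    rw [← haS, mem_esupp, ← hvv] at hx
    simp at hx
  · intro v w
    constructor
    · rintro ⟨U, μ, x, hμ, hx, hD, hw⟩
      have hV := (intertwine D e P U hP _).1 hD
      refine supp_eq e he (P * U * P⁻¹).val ((P * U * P⁻¹)⁻¹).val (by simp only [Units.mul_inv])
        (by simp only [Units.inv_mul]) μ hμ hV _ _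
        ((μ : ℂ) * x) (mul_ne_zero (by exact_mod_cast hμ) hx) ?_
      rw [hw, Matrix.smul_vecMul, Matrix.vecMul_vecMul, Matrix.vecMul_vecMul]
      congr 2
      simp only [Units.val_mul, mul_assoc, Units.inv_mul_cancel_left]
    · -- construct from a matrix in the diagonal picture
      have build : ∀ (V : GL (Fin N) ℂ) (μ : ℝ), μ ≠ 0 →
          V.val * idiag e = (μ : ℂ) • (idiag e * V.val) →
          Matrix.vecMul w.1 (P⁻¹).val = Matrix.vecMul (Matrix.vecMul v.1 (P⁻¹).val) V.val →
          simRel D v w := by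
        intro V μ hμ hV hw
        have hμc : (μ : ℂ) ≠ 0 := by exact_mod_cast hμ
        refine ⟨P⁻¹ * V * P, μ, (μ : ℂ)⁻¹, hμ, inv_ne_zero hμc, ?_, ?_⟩
        · rw [intertwine D e P _ hP]
          have : P * (P⁻¹ * V * P) * P⁻¹ = V := by group
          rw [this, hV]
        · rw [mul_inv_cancel₀ hμc, one_smul]
          have h2 := congrArg (fun z => Matrix.vecMul z P.val) hw
          simp only [Matrix.vecMul_vecMul, Units.inv_mul, Matrix.vecMul_one] at h2
          rw [h2]
          simp only [Units.val_mul]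
      rintro (h | h)
      · obtain ⟨V, hV1, hV2⟩ := exists_commuting e _ _ h
        exact build V 1 one_ne_zero (by simpa using hV1) hV2
      · set a := Matrix.vecMul v.1 (P⁻¹).val
        have hs : esupp e (Matrix.vecMul a W.val) = (esupp e a).image (fun x => -x) := by
          have q1 : ∀ x ∈ esupp e (Matrix.vecMul a W.val), ∃ y ∈ esupp e a, x = -1 * y := by
            intro x hx
            refine supp_sub e W.val (-1) hW a 1 x (by rwa [one_smul])
          have hW' : (W⁻¹).val * idiag e = ((-1 : ℝ) : ℂ) • (idiag e * (W⁻¹).val) := by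
            have := congrArg (fun Z => (W⁻¹).val * Z * (W⁻¹).val) hW
            simp only [Matrix.mul_smul, Matrix.smul_mul, mul_assoc, Units.mul_inv, mul_one,
              Units.inv_mul_cancel_left] at this
            rw [this, smul_smul]
            norm_num
          have q2 : ∀ x ∈ esupp e a, ∃ y ∈ esupp e (Matrix.vecMul a W.val), x = -1 * y := by
            intro x hx
            refine supp_sub e (W⁻¹).val (-1) hW' _ 1 x ?_
            rwa [one_smul, Matrix.vecMul_vecMul, Units.mul_inv, Matrix.vecMul_one]
          ext x
          rw [Finset.mem_image]
          constructor
          · intro hx; obtain ⟨y, hy, rfl⟩ := q1 x hx; exact ⟨y, hy, by simp⟩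
          · rintro ⟨z, hz, rfl⟩
            obtain ⟨y, hy, rfl⟩ := q2 z hz
            simpa using hy
        obtain ⟨V, hV1, hV2⟩ := exists_commuting e (Matrix.vecMul a W.val) _ (h.trans hs.symm)
        refine build (W * V) (-1) (by norm_num) ?_ ?_
        · rw [Units.val_mul, mul_assoc, hV1, ← mul_assoc, hW, Matrix.smul_mul, mul_assoc]
        · rw [hV2, Matrix.vecMul_vecMul]; rfl

/-- If `D` is a nonzero trace-free anti-hermitian matrix with exactly `k`
distinct eigenvalues with `k` odd, similar to `-D`, then `~_D` has exactly `2^{(k-1)/2}(1 + 2^{(k-1)/2}) - 1`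
equivalence classes. -/
theorem stmt9 {N k : ℕ} (hN : 1 ≤ N) (D : Matrix (Fin N) (Fin N) ℂ)
    (hD0 : D ≠ 0) (htr : D.trace = 0) (hah : Dᴴ = -D)
    (hk : (spectrum ℂ D).ncard = k)
    (hkodd : Odd k)
    (hsim : ∃ U : GL (Fin N) ℂ, -D = (U⁻¹).val * D * U.val) :
    Nat.card (Quot (simRel D)) = 2 ^ ((k - 1) / 2) * (1 + 2 ^ ((k - 1) / 2)) - 1 := by
  obtain ⟨m, hm⟩ := hkodd
  have hkm : (k - 1) / 2 = m := by omega
  rw [hkm]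
  have hH : ((-Complex.I) • D).IsHermitian := by
    rw [Matrix.IsHermitian, Matrix.conjTranspose_smul, hah]
    simp
  let e := hH.eigenvalues
  let Q : GL (Fin N) ℂ := Unitary.toUnits hH.eigenvectorUnitary
  have hsp := hH.spectral_theorem
  have hP : D = ((Q⁻¹)⁻¹).val * idiag e * (Q⁻¹).val := by
    have h1 : D = Complex.I • ((-Complex.I) • D) := by
      rw [smul_smul]; simp
    rw [h1, hsp, Unitary.conjStarAlgAut_apply]
    have h2 : idiag e = Complex.I • Matrix.diagonal (RCLike.ofReal ∘ hH.eigenvalues) := by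
      rw [idiag, ← Matrix.diagonal_smul]
      rfl
    rw [h2, inv_inv, Matrix.mul_smul, Matrix.smul_mul]
    rfl
  have hspec : spectrum ℂ D = (fun x : ℝ => Complex.I * (x : ℂ)) '' (Finset.univ.image e : Finset ℝ) := by
    rw [hP, inv_inv, spectrum.units_conjugate, idiag, spectrum_diagonal]
    ext z
    simp
  refine main_count D e Q⁻¹ hP ?_ ?_ hsim
  · by_contra hc
    push Not at hc
    apply hD0
    rw [hP]
    have : idiag e = 0 := by
      rw [idiag]; simp [hc]
    rw [this]; simp
  · rw [← hm, ← hk, hspec, Set.ncard_image_of_injective, Set.ncard_coe_finset]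
    intro x y hxy
    simpa using hxy
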